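/- Let u ≥ 2 and v ≥ 1 be coprime integers, Σ = (σ_r)_{r≥1} a sequence of permutations of {0,1,…,u−1}, k ∈ ℕ, and t ∈ ℕ with t ≥ k. Let y = Σ_{j≥1} y_j u^{-j} with y_j ∈ {0,…,u−1} and y_k > 0, and let v̄ ∈ ℕ satisfy v·v̄ ≡ 1 (mod u^k). Then for every n ∈ ℕ₀: the truncation [φ^Σ_{u/v}(n)]_t lies in the interval [[y]_k, [y]_k + 1/u^k) if and only if n ≡ Σ_{j=1}^{k} σ_j^{-1}(y_j)·u^{j−1}·v̄^j (mod u^k). -/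

import Mathlib

open Finset

/-- The auxiliary integers `z_r` in the formal `u/v`-adic expansion of an integer `z`:
`z_0 = z` and `z_{r+1} = (v·z_r − a_{r+1})/u`, where `a_{r+1} = (v·z_r) mod u` is the unique
element of `{0,…,u−1}` with `u ∣ (v·z_r − a_{r+1})`. -/
def ratZ (u v : ℕ) (z : ℤ) : ℕ → ℤ
  | 0 => z
  | r + 1 => ((v : ℤ) * ratZ u v z r - ((v : ℤ) * ratZ u v z r) % (u : ℤ)) / (u : ℤ)

/-- `ratDigit u v z r` is the digit `a_{r+1}` of the formal `u/v`-adic expansion of `z`,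
i.e. the unique element of `{0,…,u−1}` with `u ∣ (v·z_r − a_{r+1})`. -/
def ratDigit (u v : ℕ) (z : ℤ) (r : ℕ) : ℕ :=
  (((v : ℤ) * ratZ u v z r) % (u : ℤ)).toNat

/-- The generalized `u/v`-adic radical inverse function
`φ^Σ_{u/v}(n) = Σ_{r≥1} σ_r(a_r)/u^r`, where `σ r` is the permutation `σ_{r+1}` of
`{0,…,u−1}` and `a_{r+1} = ratDigit u v n r`. -/
noncomputable def ratPhi (u v : ℕ) (σ : ℕ → ℕ → ℕ) (n : ℕ) : ℝ :=
  ∑' r : ℕ, (σ r (ratDigit u v (n : ℤ) r) : ℝ) / (u : ℝ) ^ (r + 1)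

/-- The truncation `[φ^Σ_{u/v}(n)]_t = Σ_{r=1}^t σ_r(a_r)/u^r` of the generalized
`u/v`-adic radical inverse function to its first `t` prescribed digits. -/
noncomputable def ratPhiTrunc (u v : ℕ) (σ : ℕ → ℕ → ℕ) (t n : ℕ) : ℝ :=
  ∑ r ∈ Finset.range t, (σ r (ratDigit u v (n : ℤ) r) : ℝ) / (u : ℝ) ^ (r + 1)

/-- The star discrepancy `D*_N` of the first `N` points of the sequence `x` in `[0,1]^s`:
`D*_N = sup_{y ∈ (0,1]^s} |#{0 ≤ n < N : x_n^{(i)} < y^{(i)}, i=1,…,s}/N − Π_i y^{(i)}|`. -/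
noncomputable def starDisc (s N : ℕ) (x : ℕ → Fin s → ℝ) : ℝ :=
  sSup { d : ℝ | ∃ y : Fin s → ℝ, (∀ i, y i ∈ Set.Ioc (0 : ℝ) 1) ∧
    d = |(Nat.card {n : ℕ | n < N ∧ ∀ i, x n i < y i} : ℝ) / N - ∏ i, y i| }

theorem sum_digits_div_pow_succ (u : ℕ) (d : ℕ → ℕ) (t : ℕ) :
    ∑ j ∈ Finset.range (t + 1), (d j : ℝ) / (u : ℝ) ^ (j + 1) =
      ((d 0 : ℝ) + ∑ j ∈ Finset.range t, (d (j + 1) : ℝ) / (u : ℝ) ^ (j + 1)) / u := by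
  rw [Finset.sum_range_succ', add_comm, add_div, Finset.sum_div]
  simp [pow_succ, div_div]

theorem sum_digits_add_le_one {u : ℕ} (hu : 0 < u) (k : ℕ) {d : ℕ → ℕ} (hd : ∀ j, d j < u) :
    ∑ j ∈ Finset.range k, (d j : ℝ) / (u : ℝ) ^ (j + 1) + 1 / (u : ℝ) ^ k ≤ 1 := by
  induction k with
  | zero => simp
  | succ k ih =>
    have hu' : (0 : ℝ) < u := by exact_mod_cast hu
    have hdk : (d k : ℝ) + 1 ≤ u := by exact_mod_cast hd k
    have h : (d k : ℝ) / (u : ℝ) ^ (k + 1) + 1 / (u : ℝ) ^ (k + 1) ≤ 1 / (u : ℝ) ^ k := by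
      rw [← add_div, div_le_div_iff₀ (by positivity) (by positivity), pow_succ]
      nlinarith [pow_pos hu' k]
    rw [Finset.sum_range_succ]
    linarith

/-- A `u`-adic digit sum lies in the elementary interval of length `u⁻ᵏ` with left end `[y]_k`
iff its first `k` digits are those of `y`. -/
theorem sum_digits_mem_Ico_iff {u : ℕ} (hu : 0 < u) {k t : ℕ} (hkt : k ≤ t) {d y : ℕ → ℕ}
    (hd : ∀ j, d j < u) (hy : ∀ j, y j < u) :
    ∑ j ∈ Finset.range t, (d j : ℝ) / (u : ℝ) ^ (j + 1) ∈
      Set.Ico (∑ j ∈ Finset.range k, (y j : ℝ) / (u : ℝ) ^ (j + 1))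
        ((∑ j ∈ Finset.range k, (y j : ℝ) / (u : ℝ) ^ (j + 1)) + 1 / (u : ℝ) ^ k) ↔
      ∀ j < k, d j = y j := by
  have hu' : (0 : ℝ) < u := by exact_mod_cast hu
  have sum_lt_one : ∀ (t : ℕ) (d : ℕ → ℕ), (∀ j, d j < u) →
      ∑ j ∈ Finset.range t, (d j : ℝ) / (u : ℝ) ^ (j + 1) < 1 := fun t d hd => by
    have := sum_digits_add_le_one hu t hd
    have : 0 < 1 / (u : ℝ) ^ t := by positivity
    linarith
  induction k generalizing t d y with
  | zero =>
    have := sum_lt_one t d hd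
    simp only [Finset.range_zero, Finset.sum_empty, pow_zero, Set.mem_Ico]
    simp only [Nat.not_lt_zero, false_imp_iff, implies_true, iff_true]
    exact ⟨by positivity, by linarith⟩
  | succ k ih =>
    obtain ⟨t, rfl⟩ : ∃ s, t = s + 1 := ⟨t - 1, by omega⟩
    have htail := ih (Nat.le_of_succ_le_succ hkt) (fun j => hd (j + 1)) (fun j => hy (j + 1))
    have hd_lt := sum_lt_one t _ fun j => hd (j + 1)
    have hy_le := sum_digits_add_le_one hu k fun j => hy (j + 1)
    have hd_nonneg : 0 ≤ ∑ j ∈ Finset.range t, (d (j + 1) : ℝ) / (u : ℝ) ^ (j + 1) := by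
      positivity
    have hy_nonneg : 0 ≤ ∑ j ∈ Finset.range k, (y (j + 1) : ℝ) / (u : ℝ) ^ (j + 1) := by
      positivity
    have hdiv : 1 / (u : ℝ) ^ (k + 1) = 1 / (u : ℝ) ^ k / u := by rw [pow_succ, div_div]
    rw [sum_digits_div_pow_succ, sum_digits_div_pow_succ, hdiv, ← add_div, Set.mem_Ico,
      div_le_div_iff_of_pos_right hu', div_lt_div_iff_of_pos_right hu', Nat.forall_lt_succ_left']
    refine Iff.trans ?_ (and_congr_right fun _ => htail)
    rw [Set.mem_Ico]
    constructor
    · rintro ⟨h₁, h₂⟩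
      have hle : y 0 ≤ d 0 := by
        have : (y 0 : ℝ) < d 0 + 1 := by linarith
        exact Nat.lt_succ_iff.mp (by exact_mod_cast this)
      have hge : d 0 ≤ y 0 := by
        have : (d 0 : ℝ) < y 0 + 1 := by linarith
        exact Nat.lt_succ_iff.mp (by exact_mod_cast this)
      have h₀ := le_antisymm hge hle
      rw [h₀] at h₁ h₂
      exact ⟨h₀, by linarith, by linarith⟩
    · rintro ⟨h₀, h₁, h₂⟩
      rw [h₀]
      exact ⟨by linarith, by linarith⟩

theorem ratZ_succ' (u v : ℕ) (z : ℤ) (r : ℕ) :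
    ratZ u v z (r + 1) = ratZ u v (ratZ u v z 1) r := by
  induction r with
  | zero => rfl
  | succ r ih => rw [ratZ, ih]; rfl

theorem ratDigit_succ (u v : ℕ) (z : ℤ) (r : ℕ) :
    ratDigit u v z (r + 1) = ratDigit u v (ratZ u v z 1) r := by
  rw [ratDigit, ratZ_succ', ratDigit]

theorem ratDigit_cast {u : ℕ} (hu : 0 < u) (v : ℕ) (z : ℤ) (r : ℕ) :
    (ratDigit u v z r : ℤ) = (v : ℤ) * ratZ u v z r % (u : ℤ) :=
  Int.toNat_of_nonneg (Int.emod_nonneg _ (by omega))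

theorem ratDigit_lt {u : ℕ} (hu : 0 < u) (v : ℕ) (z : ℤ) (r : ℕ) : ratDigit u v z r < u := by
  have := Int.emod_lt_of_pos ((v : ℤ) * ratZ u v z r) (by exact_mod_cast hu : (0 : ℤ) < u)
  rw [← ratDigit_cast hu] at this
  exact_mod_cast this

theorem mul_eq_ratDigit_zero_add {u : ℕ} (hu : 0 < u) (v : ℕ) (z : ℤ) :
    (v : ℤ) * z = ratDigit u v z 0 + u * ratZ u v z 1 := by
  rw [ratDigit_cast hu]
  simp only [ratZ]
  rw [Int.mul_ediv_cancel' (Int.dvd_self_sub_emod)]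
  ring

/-- The first `k` digits of the `u/v`-adic expansion of `z` determine `z` modulo `u ^ k`, and
conversely. -/
theorem modEq_sum_iff_ratDigit_eq {u v vbar : ℕ} (hu : 0 < u) {k : ℕ}
    (hvbar : (v : ℤ) * vbar ≡ 1 [ZMOD (u : ℤ) ^ k]) {e : ℕ → ℕ} (he : ∀ j, e j < u) (z : ℤ) :
    z ≡ ∑ j ∈ Finset.range k, (e j : ℤ) * (u : ℤ) ^ j * (vbar : ℤ) ^ (j + 1) [ZMOD (u : ℤ) ^ k] ↔
      ∀ j < k, ratDigit u v z j = e j := by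
  induction k generalizing e z with
  | zero => simp [Int.modEq_one]
  | succ k ih =>
    have hu' : (u : ℤ) ≠ 0 := by exact_mod_cast hu.ne'
    specialize ih (hvbar.of_dvd (pow_dvd_pow _ k.le_succ)) (fun j => he (j + 1)) (ratZ u v z 1)
    set S := ∑ j ∈ Finset.range k, (e (j + 1) : ℤ) * (u : ℤ) ^ j * (vbar : ℤ) ^ (j + 1) with hS
    have hsum : ∑ j ∈ Finset.range (k + 1), (e j : ℤ) * (u : ℤ) ^ j * (vbar : ℤ) ^ (j + 1) =
        vbar * (e 0 + u * S) := by
      rw [Finset.sum_range_succ', hS, Finset.mul_sum, mul_add, Finset.mul_sum, add_comm]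
      congr 1
      · ring
      · exact Finset.sum_congr rfl fun j _ => by ring
    have hmul : z ≡ vbar * (e 0 + u * S) [ZMOD (u : ℤ) ^ (k + 1)] ↔
        ratDigit u v z 0 + u * ratZ u v z 1 ≡ e 0 + u * S [ZMOD (u : ℤ) ^ (k + 1)] := by
      rw [← mul_eq_ratDigit_zero_add hu]
      constructor
      · intro h
        have h₁ := h.mul_left (v : ℤ)
        have h₂ := hvbar.mul_right (e 0 + u * S)
        rw [mul_assoc, one_mul] at h₂
        exact h₁.trans h₂
      · intro h
        have h₁ := h.mul_left (vbar : ℤ)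
        have h₂ := hvbar.mul_right z
        rw [one_mul, mul_comm (v : ℤ), mul_assoc] at h₂
        exact h₂.symm.trans h₁
    rw [hsum, hmul, Nat.forall_lt_succ_left']
    simp only [ratDigit_succ]
    rw [← ih]
    have hcancel : (u : ℤ) * ratZ u v z 1 ≡ u * S [ZMOD (u : ℤ) ^ (k + 1)] ↔
        ratZ u v z 1 ≡ S [ZMOD (u : ℤ) ^ k] := by
      rw [pow_succ', Int.modEq_iff_dvd, Int.modEq_iff_dvd, ← mul_sub, mul_dvd_mul_iff_left hu']
    rw [← hcancel]
    constructor
    · intro h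
      have h₀ : ratDigit u v z 0 = e 0 := by
        have h₁ := h.of_dvd (dvd_pow_self (u : ℤ) k.succ_ne_zero)
        have h₂ : (ratDigit u v z 0 : ℤ) ≡ e 0 [ZMOD u] := by
          simpa [Int.ModEq] using h₁
        exact (Int.natCast_modEq_iff.mp h₂).eq_of_lt_of_lt (ratDigit_lt hu v z 0) (he 0)
      rw [h₀] at h
      exact ⟨h₀, Int.ModEq.add_left_cancel' _ h⟩
    · rintro ⟨h₀, h⟩
      rw [h₀]
      exact h.add_left _

/-- **Lemma 2, item 1.** With digits `y_j` (here `y j = y_{j+1}`), `y_k > 0`, `t ≥ k`, and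
`v·v̄ ≡ 1 (mod u^k)`: `[φ^Σ_{u/v}(n)]_t ∈ [[y]_k, [y]_k + 1/u^k)` iff
`n ≡ Σ_{j=1}^{k} σ_j^{-1}(y_j)·u^{j−1}·v̄^j (mod u^k)`. -/
theorem ratPhiTrunc_mem_Ico_iff_modEq
    (u v : ℕ) (hu : 2 ≤ u) (hv : 1 ≤ v) (huv : Nat.Coprime u v)
    (σ σinv : ℕ → ℕ → ℕ)
    (hσ : ∀ r, Set.BijOn (σ r) (Set.Iio u) (Set.Iio u))
    (hinv : ∀ r, Set.InvOn (σinv r) (σ r) (Set.Iio u) (Set.Iio u))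
    (hinvmap : ∀ r, Set.MapsTo (σinv r) (Set.Iio u) (Set.Iio u))
    (k t : ℕ) (hk : 1 ≤ k) (hkt : k ≤ t)
    (y : ℕ → ℕ) (hy : ∀ j, y j < u) (hyk : 0 < y (k - 1))
    (vbar : ℕ) (hvbar : v * vbar ≡ 1 [MOD u ^ k]) (n : ℕ) :
    ratPhiTrunc u v σ t n ∈
      Set.Ico (∑ j ∈ Finset.range k, (y j : ℝ) / (u : ℝ) ^ (j + 1))
        ((∑ j ∈ Finset.range k, (y j : ℝ) / (u : ℝ) ^ (j + 1)) + 1 / (u : ℝ) ^ k) ↔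
      n ≡ ∑ j ∈ Finset.range k, σinv j (y j) * u ^ j * vbar ^ (j + 1) [MOD u ^ k] := by
  have hu₀ : 0 < u := by omega
  have hvbar' : (v : ℤ) * vbar ≡ 1 [ZMOD (u : ℤ) ^ k] := by
    exact_mod_cast Int.natCast_modEq_iff.mpr hvbar
  have hdigit := modEq_sum_iff_ratDigit_eq hu₀ hvbar' (fun j => hinvmap j (hy j)) (n : ℤ)
  rw [ratPhiTrunc, sum_digits_mem_Ico_iff hu₀ hkt
    (fun j => (hσ j).mapsTo (ratDigit_lt hu₀ v n j)) hy, ← Int.natCast_modEq_iff]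
  push_cast
  rw [hdigit]
  refine forall₂_congr fun j _ => ⟨fun h => ?_, fun h => ?_⟩
  · rw [← h, (hinv j).1 (ratDigit_lt hu₀ v n j)]
  · rw [h, (hinv j).2 (hy j)]
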